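/- Let N ∈ ℕ be large and let δ > 0 be small. Then there exist functions g : ℝ → ℝ and g_{N+1} : ℝ → ℝ such that, defining g_j(x) := g(x − j) for all integers j with |j| ≤ N, the following hold: (i) Σ_{|j| ≤ N} g_j(x) + g_{N+1}(x) = 1 for all x ∈ ℝ; (ii) g(x) ≥ 0 for all x ∈ ℝ, and g(x) ≤ δ whenever |x| > 1; (iii) g_{N+1}(x) ≥ 0 for all x ∈ ℝ, and g_{N+1}(x) ≤ δ whenever |x| ≤ N; (iv) g is infinitely differentiable and for every l ∈ ℕ and every x ∈ ℝ one has |d^l g(x)/dx^l| ≤ (1/(π(l+1)))·(2π/δ)^{l+1}. -/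

import Mathlib

open MeasureTheory

noncomputable section

def Cf (m : ℕ) (u : ℝ) : ℝ :=
  ∫ t in (0:ℝ)..1, (1 - t) * (2 * t) ^ m * Real.cos (2 * t * u + m * (Real.pi / 2))

lemma Cf_hasDerivAt (m : ℕ) (u : ℝ) : HasDerivAt (Cf m) (Cf (m + 1) u) u := by
  have key := intervalIntegral.hasDerivAt_integral_of_dominated_loc_of_deriv_le
    (μ := volume) (a := (0:ℝ)) (b := 1) (s := Set.univ) (x₀ := u)
    (F := fun u t => (1 - t) * (2 * t) ^ m * Real.cos (2 * t * u + m * (Real.pi / 2)))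
    (F' := fun u t => (1 - t) * (2 * t) ^ (m + 1) *
      Real.cos (2 * t * u + (m + 1 : ℕ) * (Real.pi / 2)))
    (bound := fun t => |(1 - t) * (2 * t) ^ (m + 1)|) Filter.univ_mem
    (Filter.Eventually.of_forall fun x => by
      apply Continuous.aestronglyMeasurable; fun_prop)
    (by apply Continuous.intervalIntegrable; fun_prop)
    (by apply Continuous.aestronglyMeasurable; fun_prop)
    (by
      refine Filter.Eventually.of_forall fun t _ x _ => ?_
      rw [Real.norm_eq_abs, abs_mul]
      exact mul_le_of_le_one_right (abs_nonneg _) (Real.abs_cos_le_one _))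
    (by apply Continuous.intervalIntegrable; fun_prop)
    (by
      refine Filter.Eventually.of_forall fun t _ x _ => ?_
      have h1 : HasDerivAt (fun x : ℝ => 2 * t * x + m * (Real.pi / 2)) (2 * t) x := by
        simpa using ((hasDerivAt_id x).const_mul (2 * t)).add_const (m * (Real.pi / 2))
      have h2 := (h1.cos).const_mul ((1 - t) * (2 * t) ^ m)
      refine h2.congr_deriv ?_
      have : 2 * t * x + ((m + 1 : ℕ) : ℝ) * (Real.pi / 2)
          = (2 * t * x + m * (Real.pi / 2)) + Real.pi / 2 := by push_cast; ring
      simp only [this, Real.cos_add_pi_div_two]; ring)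
  exact key.2

lemma Cf_bound (m : ℕ) (u : ℝ) : |Cf m u| ≤ 2 ^ m / (m + 1) := by
  have h : ∫ t in (0:ℝ)..1, (2:ℝ) ^ m * t ^ m = 2 ^ m / (m + 1) := by
    rw [intervalIntegral.integral_const_mul, integral_pow]; simp; field_simp
  rw [← h, ← Real.norm_eq_abs]
  apply intervalIntegral.norm_integral_le_of_norm_le zero_le_one
  · refine Filter.Eventually.of_forall fun t ht => ?_
    rw [Real.norm_eq_abs, abs_mul, abs_mul, abs_of_nonneg (by linarith [ht.2] : 0 ≤ 1 - t),
      abs_of_nonneg (by have := ht.1; positivity), mul_pow]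
    have h0 : 0 ≤ (2:ℝ) ^ m * t ^ m := by have := ht.1; positivity
    calc (1 - t) * (2 ^ m * t ^ m) * |Real.cos (2 * t * u + m * (Real.pi / 2))|
        ≤ (1 - t) * (2 ^ m * t ^ m) * 1 := by
          apply mul_le_mul_of_nonneg_left (Real.abs_cos_le_one _)
          exact mul_nonneg (by linarith [ht.2]) h0
      _ ≤ _ := by nlinarith [ht.1]
  · apply Continuous.intervalIntegrable; fun_prop

def hf (u : ℝ) : ℝ := 2 * Cf 0 u

lemma hf_hasDerivAt (u : ℝ) : HasDerivAt hf (2 * Cf 1 u) u := (Cf_hasDerivAt 0 u).const_mul 2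

lemma hf_cont : Continuous hf :=
  continuous_iff_continuousAt.2 fun u => (hf_hasDerivAt u).continuousAt

lemma hf_eq (u : ℝ) (hu : u ≠ 0) : hf u = (Real.sin u / u) ^ 2 := by
  have := intervalIntegral.integral_eq_sub_of_hasDerivAt (a := (0:ℝ)) (b := 1)
    (f := fun t => (1 - t) * (Real.sin (2 * t * u) / (2 * u)) - Real.cos (2 * t * u) / (4 * u ^ 2))
    (f' := fun t => (1 - t) * Real.cos (2 * t * u))
    (fun t _ => by
      have h1 : HasDerivAt (fun t : ℝ => 2 * t * u) (2 * u) t := by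
        simpa using ((hasDerivAt_id t).const_mul 2).mul_const u
      have h2 : HasDerivAt (fun t : ℝ => 1 - t) (-1) t := by
        simpa using (hasDerivAt_id t).const_sub 1
      refine ((h2.mul (h1.sin.div_const (2 * u))).sub (h1.cos.div_const (4 * u ^ 2))).congr_deriv ?_
      field_simp
      ring)
    (by apply Continuous.intervalIntegrable; fun_prop)
  have e : Cf 0 u = ∫ t in (0:ℝ)..1, (1 - t) * Real.cos (2 * t * u) := by
    simp [Cf]
  rw [hf, e, this]
  have := Real.cos_two_mul u
  have h3 := Real.sin_sq_add_cos_sq u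
  simp
  rw [this]
  field_simp
  linarith

lemma hf_zero : hf 0 = 1 := by
  have : ∫ t in (0:ℝ)..1, (1 - t) = 1 / 2 := by
    rw [intervalIntegral.integral_sub (by simp) (by simp)]
    simp; norm_num
  simp [hf, Cf, this]

lemma hf_nonneg (u : ℝ) : 0 ≤ hf u := by
  by_cases hu : u = 0
  · rw [hu, hf_zero]; norm_num
  · rw [hf_eq u hu]; positivity

lemma hf_even (u : ℝ) : hf (-u) = hf u := by
  by_cases hu : u = 0
  · simp [hu]
  · rw [hf_eq u hu, hf_eq _ (neg_ne_zero.2 hu)]; simp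

lemma hf_le_inv (u : ℝ) (hu : u ≠ 0) : hf u ≤ (u ^ 2)⁻¹ := by
  rw [hf_eq u hu, div_pow, div_eq_mul_inv]
  exact mul_le_of_le_one_left (by positivity) (Real.sin_sq_le_one u)

lemma hf_le_one (u : ℝ) : hf u ≤ 1 := by
  by_cases hu : u = 0
  · rw [hu, hf_zero]
  · rw [hf_eq u hu, div_pow, div_le_one (by positivity)]
    exact sq_le_sq.2 Real.abs_sin_le_abs

lemma hf_lower (u : ℝ) (h0 : 0 ≤ u) (h1 : u ≤ 1) : 1 - u ^ 2 ≤ hf u := by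
  rcases h0.eq_or_lt with h | h
  · rw [← h, hf_zero]; norm_num
  · rw [hf_eq u h.ne']
    have := Real.sin_gt_sub_cube h
    have h2 : 1 - u ^ 2 / 4 ≤ Real.sin u / u := by
      rw [le_div_iff₀ h]; nlinarith [pow_pos h 3]
    nlinarith [sq_nonneg u]

lemma hf_int : Integrable hf := by
  refine Integrable.mono' ((integrable_inv_one_add_sq).const_mul 2)
    hf_cont.aestronglyMeasurable (Filter.Eventually.of_forall fun u => ?_)
  rw [Real.norm_eq_abs, abs_of_nonneg (hf_nonneg u), ← div_eq_mul_inv, le_div_iff₀ (by positivity)]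
  have h1 := hf_le_one u
  by_cases hu : u = 0
  · simp [hu, hf_zero]
  · have h2 := hf_le_inv u hu
    have : hf u * u ^ 2 ≤ 1 := by
      rw [← le_div_iff₀ (by positivity)]; simpa using h2
    linarith

def If : ℝ := ∫ u, hf u

lemma If_ge : 4 / 3 ≤ If := by
  have h1 : ∫ u in Set.Ioc (-1:ℝ) 1, hf u ≤ If :=
    setIntegral_le_integral hf_int (Filter.Eventually.of_forall hf_nonneg)
  rw [← intervalIntegral.integral_of_le (by norm_num)] at h1
  have h2 : ∫ u in (-1:ℝ)..1, (1 - u ^ 2) ≤ ∫ u in (-1:ℝ)..1, hf u := by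
    apply intervalIntegral.integral_mono_on (by norm_num)
    · apply Continuous.intervalIntegrable; fun_prop
    · exact hf_cont.intervalIntegrable _ _
    · intro u hu
      rcases le_total 0 u with h | h
      · exact hf_lower u h hu.2
      · have := hf_lower (-u) (by linarith) (by linarith [hu.1])
        rw [hf_even] at this; simpa using this
  have h3 : ∫ u in (-1:ℝ)..1, (1 - u ^ 2) = 4 / 3 := by
    rw [intervalIntegral.integral_sub (by simp) (by apply Continuous.intervalIntegrable; fun_prop)]
    simp; norm_num
  linarith

lemma tail_right (a : ℝ) (ha : 0 < a) : ∫ u in Set.Ioi a, hf u ≤ 1 / a := by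
  have h := integral_Ioi_rpow_of_lt (a := -2) (by norm_num) ha
  have hi := integrableOn_Ioi_rpow_of_lt (a := -2) (by norm_num) ha
  have e : -a ^ ((-2:ℝ) + 1) / (-2 + 1) = 1 / a := by
    have : (-2:ℝ) + 1 = -1 := by norm_num
    rw [this, Real.rpow_neg_one]; field_simp
  rw [← e, ← h]
  apply setIntegral_mono_on hf_int.integrableOn hi measurableSet_Ioi
  intro u hu
  have hu' : 0 < u := ha.trans hu
  refine (hf_le_inv u hu'.ne').trans (le_of_eq ?_)
  rw [Real.rpow_neg hu'.le]; norm_cast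

lemma tail_left (a : ℝ) (ha : 0 < a) : ∫ u in Set.Iic (-a), hf u ≤ 1 / a := by
  have : ∫ u in Set.Iic (-a), hf u = ∫ u in Set.Ioi a, hf u := by
    rw [← integral_comp_neg_Ioi]
    simp [hf_even]
  rw [this]; exact tail_right a ha

lemma smooth_seq (D : ℕ → ℝ → ℝ) (h : ∀ m x, HasDerivAt (D m) (D (m + 1) x) x) :
    (∀ m, iteratedDeriv m (D 0) = D m) ∧ ContDiff ℝ (⊤ : ℕ∞) (D 0) := by
  have h1 : ∀ m, iteratedDeriv m (D 0) = D m := by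
    intro m
    induction m with
    | zero => simp
    | succ k ih => rw [iteratedDeriv_succ, ih]; ext x; exact (h k x).deriv
  refine ⟨h1, contDiff_of_differentiable_iteratedDeriv fun m _ => ?_⟩
  rw [h1]; exact fun x => (h m x).differentiableAt

def Gf (u : ℝ) : ℝ := ∫ t in (0:ℝ)..u, hf t

lemma Gf_hasDerivAt (u : ℝ) : HasDerivAt Gf (hf u) u :=
  intervalIntegral.integral_hasDerivAt_right (hf_cont.intervalIntegrable _ _)
    (hf_cont.stronglyMeasurableAtFilter _ _) hf_cont.continuousAt

lemma Gf_sub (a b : ℝ) : Gf b - Gf a = ∫ t in a..b, hf t :=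
  intervalIntegral.integral_interval_sub_left (hf_cont.intervalIntegrable _ _)
    (hf_cont.intervalIntegrable _ _)

lemma Gf_sub_nonneg (a b : ℝ) (h : a ≤ b) : 0 ≤ Gf b - Gf a := by
  rw [Gf_sub]; exact intervalIntegral.integral_nonneg h fun u _ => hf_nonneg u

lemma Gf_split (a b : ℝ) (_h : a ≤ b) :
    (∫ u in Set.Iic a, hf u) + (Gf b - Gf a) + (∫ u in Set.Ioi b, hf u) = If := by
  have h1 := intervalIntegral.integral_Iic_sub_Iic (a := a) (b := b)
    hf_int.integrableOn hf_int.integrableOn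
  have h2 := intervalIntegral.integral_Iic_add_Ioi (b := b)
    hf_int.integrableOn hf_int.integrableOn
  rw [Gf_sub, ← h1, If, ← h2]; ring

lemma Gf_sub_le_right (a b : ℝ) (ha : 0 < a) (h : a ≤ b) : Gf b - Gf a ≤ 1 / a := by
  refine le_trans ?_ (tail_right a ha)
  rw [Gf_sub, intervalIntegral.integral_of_le h]
  exact setIntegral_mono_set hf_int.integrableOn (Filter.Eventually.of_forall hf_nonneg)
    (Set.Ioc_subset_Ioi_self).eventuallyLE

lemma Gf_sub_le_left (a b : ℝ) (hb : 0 < b) (h : a ≤ -b) : Gf (-b) - Gf a ≤ 1 / b := by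
  refine le_trans ?_ (tail_left b hb)
  rw [Gf_sub, intervalIntegral.integral_of_le h]
  exact setIntegral_mono_set hf_int.integrableOn (Filter.Eventually.of_forall hf_nonneg)
    (Set.Ioc_subset_Iic_self).eventuallyLE

def Df (α : ℝ) : ℕ → ℝ → ℝ
  | 0 => fun x => (Gf (α * x + α / 2) - Gf (α * x - α / 2)) / If
  | m + 1 => fun x => α ^ (m + 1) * (2 * Cf m (α * x + α / 2) - 2 * Cf m (α * x - α / 2)) / If

lemma Df_hasDerivAt (α : ℝ) (m : ℕ) (x : ℝ) : HasDerivAt (Df α m) (Df α (m + 1) x) x := by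
  have ha : HasDerivAt (fun x => α * x + α / 2) α x := by
    simpa using ((hasDerivAt_id x).const_mul α).add_const (α / 2)
  have hb : HasDerivAt (fun x => α * x - α / 2) α x := by
    simpa using ((hasDerivAt_id x).const_mul α).sub_const (α / 2)
  cases m with
  | zero =>
    have h1 := (Gf_hasDerivAt (α * x + α / 2)).comp x ha
    have h2 := (Gf_hasDerivAt (α * x - α / 2)).comp x hb
    refine ((h1.sub h2).div_const If).congr_deriv ?_
    simp only [Df, hf]; ring
  | succ k =>
    have h1 := ((Cf_hasDerivAt k (α * x + α / 2)).comp x ha).const_mul 2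
    have h2 := ((Cf_hasDerivAt k (α * x - α / 2)).comp x hb).const_mul 2
    refine (((h1.sub h2).const_mul (α ^ (k + 1))).div_const If).congr_deriv ?_
    simp only [Df]; ring

lemma Df_sum (α x : ℝ) (N : ℕ) :
    ∑ j ∈ Finset.Icc (-(N : ℤ)) (N : ℤ), Df α 0 (x - (j : ℝ)) =
      (Gf (α * (x + N) + α / 2) - Gf (α * (x - N) - α / 2)) / If := by
  induction N with
  | zero => simp [Df]
  | succ n ih =>
    have : Finset.Icc (-((n + 1 : ℕ) : ℤ)) ((n + 1 : ℕ) : ℤ) =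
        insert (-((n : ℤ) + 1)) (insert ((n : ℤ) + 1) (Finset.Icc (-(n : ℤ)) (n : ℤ))) := by
      ext j; simp only [Finset.mem_Icc, Finset.mem_insert]; push_cast; omega
    rw [this, Finset.sum_insert, Finset.sum_insert, ih]
    · simp only [Df]
      push_cast
      have e1 : α * (x - (-((n:ℝ) + 1))) - α / 2 = α * (x + n) + α / 2 := by ring
      have e2 : α * (x - ((n:ℝ) + 1)) + α / 2 = α * (x - n) - α / 2 := by ring
      rw [e1, e2, sub_neg_eq_add]
      ring
    · simp
    · simp only [Finset.mem_Icc, Finset.mem_insert]; omega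

end


/-- Approximation Result 1: a smooth partition of unity on ℝ adapted to unit intervals
centred at the integers `j` with `|j| ≤ N`, with precision parameter `δ`. -/
theorem smooth_partition_of_unity :
    ∃ (N₀ : ℕ) (δ₀ : ℝ), 0 < δ₀ ∧
      ∀ N : ℕ, N₀ ≤ N → ∀ δ : ℝ, 0 < δ → δ ≤ δ₀ →
        ∃ g gLast : ℝ → ℝ,
          -- (i) partition of unity
          (∀ x : ℝ, (∑ j ∈ Finset.Icc (-(N : ℤ)) (N : ℤ), g (x - (j : ℝ))) + gLast x = 1) ∧
          -- (ii) g nonnegative, small outside [-1,1]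
          (∀ x : ℝ, 0 ≤ g x) ∧ (∀ x : ℝ, 1 < |x| → g x ≤ δ) ∧
          -- (iii) gLast nonnegative, small on [-N,N]
          (∀ x : ℝ, 0 ≤ gLast x) ∧ (∀ x : ℝ, |x| ≤ (N : ℝ) → gLast x ≤ δ) ∧
          -- (iv) smoothness and derivative bounds
          ContDiff ℝ (⊤ : ℕ∞) g ∧
          (∀ (l : ℕ) (x : ℝ),
            |iteratedDeriv l g x| ≤ (1 / (Real.pi * (l + 1))) * (2 * Real.pi / δ) ^ (l + 1)) := by
  refine ⟨0, 1 / 2, by norm_num, fun N _ δ hδ hδ2 => ?_⟩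
  have hI := If_ge
  have hI0 : 0 < If := by linarith
  have hpi := Real.pi_gt_three
  obtain ⟨α, hα⟩ : ∃ α, α = Real.pi / δ := ⟨_, rfl⟩
  have hα0 : 0 < α := by rw [hα]; positivity
  have hαδ : α * δ = Real.pi := by rw [hα]; field_simp
  have hsmall : 1 / (α / 2) + 1 / (α / 2) ≤ δ * If := by
    have : 1 / (α / 2) + 1 / (α / 2) = 4 / α := by field_simp; norm_num
    rw [this, div_le_iff₀ hα0]
    calc (4:ℝ) ≤ Real.pi * If := by nlinarith
      _ = _ := by rw [← hαδ]; ring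
  have hp : 0 < 1 / (α / 2) := by positivity
  obtain ⟨hD, hC⟩ := smooth_seq (Df α) (Df_hasDerivAt α)
  have hN : (0:ℝ) ≤ N := Nat.cast_nonneg N
  have hle : ∀ x : ℝ, α * (x - N) - α / 2 ≤ α * (x + N) + α / 2 := fun x => by nlinarith
  have hg0 : ∀ x, 0 ≤ Df α 0 x := fun x =>
    div_nonneg (Gf_sub_nonneg _ _ (by linarith)) hI0.le
  have hT1 : ∀ a, 0 ≤ ∫ u in Set.Iic a, hf u := fun a => integral_nonneg hf_nonneg
  have hT2 : ∀ a, 0 ≤ ∫ u in Set.Ioi a, hf u := fun a => integral_nonneg hf_nonneg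
  refine ⟨Df α 0, fun x => 1 - (Gf (α * (x + N) + α / 2) - Gf (α * (x - N) - α / 2)) / If,
    fun x => ?_, hg0, fun x hx => ?_, fun x => ?_, fun x hx => ?_, hC, fun l x => ?_⟩
  · rw [Df_sum]; ring
  · simp only [Df]
    rw [div_le_iff₀ hI0]
    refine le_trans ?_ (le_trans (by linarith : 1 / (α / 2) ≤ _) hsmall)
    rcases lt_abs.1 hx with h | h
    · refine (Gf_sub_le_right _ _ (by nlinarith) (by linarith)).trans ?_
      exact one_div_le_one_div_of_le (by positivity) (by nlinarith)
    · have := Gf_sub_le_left (α * x - α / 2) (-(α * x + α / 2)) (by nlinarith) (by linarith)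
      rw [neg_neg] at this
      refine this.trans ?_
      exact one_div_le_one_div_of_le (by positivity) (by nlinarith)
  · have := Gf_split _ _ (hle x)
    rw [sub_nonneg, div_le_one hI0]
    linarith [hT1 (α * (x - N) - α / 2), hT2 (α * (x + N) + α / 2)]
  · have h := Gf_split _ _ (hle x)
    obtain ⟨h1, h2⟩ := abs_le.1 hx
    have t1 := tail_left (-(α * (x - N) - α / 2)) (by nlinarith)
    have t2 := tail_right (α * (x + N) + α / 2) (by nlinarith)
    rw [neg_neg] at t1
    have t3 := one_div_le_one_div_of_le (by positivity : 0 < α / 2)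
      (by nlinarith : α / 2 ≤ -(α * (x - N) - α / 2))
    have t4 := one_div_le_one_div_of_le (by positivity : 0 < α / 2)
      (by nlinarith : α / 2 ≤ α * (x + N) + α / 2)
    rw [sub_le_iff_le_add, ← sub_le_iff_le_add', le_div_iff₀ hI0]
    linarith
  · rw [hD]
    have e : 2 * Real.pi / δ = 2 * α := by rw [hα]; ring
    cases l with
    | zero =>
      rw [abs_of_nonneg (hg0 x)]
      have h1 : Df α 0 x ≤ 1 := by
        simp only [Df]
        rw [div_le_one hI0]
        have := Gf_split (α * x - α / 2) (α * x + α / 2) (by linarith)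
        linarith [hT1 (α * x - α / 2), hT2 (α * x + α / 2)]
      have h2 : 1 / (Real.pi * (((0:ℕ):ℝ) + 1)) * (2 * Real.pi / δ) ^ (0 + 1) = 2 / δ := by
        simp; field_simp
      rw [h2]
      refine h1.trans ?_
      rw [le_div_iff₀ hδ]; linarith
    | succ m =>
      rw [e]
      simp only [Df]
      have b1 := Cf_bound m (α * x + α / 2)
      have b2 := Cf_bound m (α * x - α / 2)
      have b3 : |2 * Cf m (α * x + α / 2) - 2 * Cf m (α * x - α / 2)|
          ≤ 4 * (2 ^ m / (m + 1)) := by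
        rw [abs_le] at *; constructor <;> linarith
      rw [abs_div, abs_mul, abs_of_pos hI0, abs_of_pos (pow_pos hα0 (m + 1)), div_le_iff₀ hI0]
      refine (mul_le_mul_of_nonneg_left b3 (by positivity)).trans ?_
      have hm : (0:ℝ) ≤ m := Nat.cast_nonneg m
      have e1 : α ^ (m + 1) * (4 * (2 ^ m / ((m:ℝ) + 1)))
          = (2 * α) ^ (m + 1) * (2 / (m + 1)) := by rw [mul_pow]; ring
      have e2 : 1 / (Real.pi * (((m + 1 : ℕ) : ℝ) + 1)) * (2 * α) ^ (m + 1 + 1) * If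
          = (2 * α) ^ (m + 1) * (2 * If / (δ * (m + 2))) := by
        have : ((m + 1 : ℕ) : ℝ) + 1 = m + 2 := by push_cast; ring
        rw [this, pow_succ (2 * α) (m + 1), ← hαδ]; field_simp
      rw [e1, e2]
      apply mul_le_mul_of_nonneg_left _ (by positivity)
      rw [div_le_div_iff₀ (by positivity) (by positivity)]
      nlinarith
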